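/- arXiv:2002.06912 — 2 statements merged into one kernel-verified Lean document; each statement's English description precedes it below -/
import Mathlib

section
/- Let D[X,Y] be a finite bipartite digraph in which for every pair of distinct vertices u ∈ X, v ∈ Y, at most one of (u,v) or (v,u) is an arc of D. If D has no 4-cycles, then D has a feedback arc set of size at most Λ(D). -/
variable {V : Type*}

/-- `l` is a cycle in the digraph with arc set `A`: distinct vertices, length ≥ 2,
consecutive arcs (cyclically). -/
def IsCycleIn (A : Set (V × V)) (l : List V) : Prop :=
  l.Nodup ∧ 2 ≤ l.length ∧
    ∀ i : Fin l.length,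
      (l.get i, l.get ⟨(i.1 + 1) % l.length, Nat.mod_lt _ i.pos⟩) ∈ A

/-- The digraph with arc set `A` has no cycles. -/
def Acyclic (A : Set (V × V)) : Prop := ∀ l : List V, ¬ IsCycleIn A l

/-- `F` is a feedback arc set of the digraph with arc set `A`. -/
def IsFAS (A F : Set (V × V)) : Prop := F ⊆ A ∧ Acyclic (A \ F)

/-- The arc set of the reversed digraph `D^R` (also serves as `F^R` for arc sets). -/
def rev (A : Set (V × V)) : Set (V × V) := {p | (p.2, p.1) ∈ A}

/-- `(a,b,c,d)` is an induced path on four vertices. -/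
def IsInducedP4 (A : Set (V × V)) (a b c d : V) : Prop :=
  a ≠ b ∧ a ≠ c ∧ a ≠ d ∧ b ≠ c ∧ b ≠ d ∧ c ≠ d ∧
    (a, b) ∈ A ∧ (b, c) ∈ A ∧ (c, d) ∈ A ∧
    (a, c) ∉ A ∧ (c, a) ∉ A ∧ (a, d) ∉ A ∧ (d, a) ∉ A ∧ (b, d) ∉ A ∧ (d, b) ∉ A

/-- `first_D(v)`: number of `~2`-equivalence classes of induced 4-vertex paths with `v`
as first vertex; such a class is determined by the (third, fourth) vertex pair. -/
noncomputable def firstD (A : Set (V × V)) (v : V) : ℕ :=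
  Set.ncard {p : V × V | ∃ b, IsInducedP4 A v b p.1 p.2}

/-- `sec_D(v)`: number of `~3`-equivalence classes of induced 4-vertex paths with `v`
as second vertex; such a class is determined by the (first, fourth) vertex pair. -/
noncomputable def secD (A : Set (V × V)) (v : V) : ℕ :=
  Set.ncard {p : V × V | ∃ c, IsInducedP4 A p.1 v c p.2}

/-- `Λ(D)` for a bipartite digraph with bipartition `(X, Y)`. -/
noncomputable def Lambda (A : Set (V × V)) (X Y : Set V) : ℕ :=
  Set.ncard {p : V × V | p.1 ∈ X ∧ p.2 ∈ Y ∧ (p.1, p.2) ∉ A ∧ (p.2, p.1) ∉ A}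

def Nplus (A : Set (V × V)) (v : V) : Set V := {w | (v, w) ∈ A}
def Nminus (A : Set (V × V)) (v : V) : Set V := {w | (w, v) ∈ A}
def NplusS (A : Set (V × V)) (S : Set V) : Set V := {w | ∃ v ∈ S, (v, w) ∈ A}

/-- Arc set of the subdigraph induced by the vertex set `S`. -/
def inducedArcs (A : Set (V × V)) (S : Set V) : Set (V × V) :=
  {p ∈ A | p.1 ∈ S ∧ p.2 ∈ S}

/-- The set of arcs of the cycle `l`. -/
def cycleArcs (l : List V) : Set (V × V) :=
  {p | ∃ i : Fin l.length, p = (l.get i, l.get ⟨(i.1 + 1) % l.length, Nat.mod_lt _ i.pos⟩)}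

/-- A cycle is induced (chordless) if every arc between its vertices joins cyclically
consecutive vertices. -/
def IsInducedCycle (A : Set (V × V)) (l : List V) : Prop :=
  IsCycleIn A l ∧ ∀ i j : Fin l.length,
    (l.get i, l.get j) ∈ A → (j.1 = (i.1 + 1) % l.length ∨ i.1 = (j.1 + 1) % l.length)

/-- `(a,b,c,d)` is a 4-cycle. -/
def Is4Cycle (A : Set (V × V)) (q : V × V × V × V) : Prop :=
  q.1 ≠ q.2.1 ∧ q.1 ≠ q.2.2.1 ∧ q.1 ≠ q.2.2.2 ∧ q.2.1 ≠ q.2.2.1 ∧ q.2.1 ≠ q.2.2.2 ∧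
    q.2.2.1 ≠ q.2.2.2 ∧
    (q.1, q.2.1) ∈ A ∧ (q.2.1, q.2.2.1) ∈ A ∧ (q.2.2.1, q.2.2.2) ∈ A ∧ (q.2.2.2, q.1) ∈ A

/-- The arcs of the 4-cycle `q`. -/
def arcs4 (q : V × V × V × V) : Set (V × V) :=
  {(q.1, q.2.1), (q.2.1, q.2.2.1), (q.2.2.1, q.2.2.2), (q.2.2.2, q.1)}

open Classical in
/-- Number of pairs in `S × S'` related by `R`. -/
noncomputable def eCount {V : Type*} (R : V → V → Prop) (S S' : Finset V) : ℕ :=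
  ∑ x ∈ S, ∑ y ∈ S', if R x y then 1 else 0

theorem eCount_mono {V : Type*} {R Q : V → V → Prop} {S S' : Finset V}
    (h : ∀ x ∈ S, ∀ y ∈ S', R x y → Q x y) : eCount R S S' ≤ eCount Q S S' := by
  classical
  unfold eCount
  refine Finset.sum_le_sum fun x hx => Finset.sum_le_sum fun y hy => ?_
  have := h x hx y hy
  split_ifs <;> simp_all

theorem eCount_zero {V : Type*} {R : V → V → Prop} {S S' : Finset V}
    (h : ∀ x ∈ S, ∀ y ∈ S', ¬ R x y) : eCount R S S' = 0 := by
  classical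
  unfold eCount
  refine Finset.sum_eq_zero fun x hx => Finset.sum_eq_zero fun y hy => ?_
  simp [h x hx y hy]

theorem eCount_swap {V : Type*} (R : V → V → Prop) (S S' : Finset V) :
    eCount (fun x y => R y x) S S' = eCount R S' S := by
  classical
  unfold eCount
  rw [Finset.sum_comm]

theorem eCount_card {V : Type*} (R : V → V → Prop) (S S' : Finset V) :
    eCount R S S' = Set.ncard {p : V × V | p.1 ∈ S ∧ p.2 ∈ S' ∧ R p.1 p.2} := by
  classical
  unfold eCount
  rw [← Finset.sum_product', ← Finset.card_filter, ← Set.ncard_coe_finset]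
  congr 1
  ext p
  simp [and_assoc]

open Classical in
theorem eCount_split {V : Type*} (R : V → V → Prop) {S T : Finset V} (h : S ⊆ T) :
    eCount R T T = eCount R S S + eCount R S (T \ S) + eCount R (T \ S) S
      + eCount R (T \ S) (T \ S) := by
  unfold eCount
  have key : ∀ f : V → ℕ, ∑ x ∈ T, f x = ∑ x ∈ S, f x + ∑ x ∈ T \ S, f x := by
    intro f
    rw [add_comm, Finset.sum_sdiff h]
  rw [key]
  simp only [key, Finset.sum_add_distrib]
  ring

/-- nonadjacent pairs on different sides -/
def NonAdj {V : Type*} (R : V → V → Prop) (col : V → Prop) (x y : V) : Prop :=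
  ¬ (col x ↔ col y) ∧ ¬ R x y ∧ ¬ R y x

def firstRel {V : Type*} (R : V → V → Prop) (T : Finset V) (v c d : V) : Prop :=
  ∃ b ∈ T, R v b ∧ R b c ∧ R c d ∧ ¬ R v d ∧ ¬ R d v

def secRel {V : Type*} (R : V → V → Prop) (T : Finset V) (v a d : V) : Prop :=
  ∃ c ∈ T, R a v ∧ R v c ∧ R c d ∧ ¬ R a d ∧ ¬ R d a

theorem sum_rev {V : Type*} (R : V → V → Prop) (T : Finset V) :
    ∑ v ∈ T, eCount (firstRel (fun x y => R y x) T v) T T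
      = ∑ v ∈ T, eCount (secRel R T v) T T := by
  classical
  unfold eCount
  -- left summand at (v,c,d) equals right summand at (c,d,v)
  have : ∀ v c d, firstRel (fun x y => R y x) T v c d ↔ secRel R T c d v := by
    intro v c d
    unfold firstRel secRel
    constructor <;> rintro ⟨b, hb, h⟩ <;> exact ⟨b, hb, by tauto⟩
  simp only [this]
  rw [Finset.sum_comm]
  refine Finset.sum_congr rfl fun c _ => ?_
  rw [Finset.sum_comm]

theorem nonAdj_symm {V : Type*} (R : V → V → Prop) (col : V → Prop) (x y : V) :
    NonAdj R col x y ↔ NonAdj R col y x := by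
  unfold NonAdj; tauto

theorem eCount_nonAdj_swap {V : Type*} (R : V → V → Prop) (col : V → Prop) (S S' : Finset V) :
    eCount (NonAdj R col) S S' = eCount (NonAdj R col) S' S := by
  rw [← eCount_swap]
  exact le_antisymm (eCount_mono fun x _ y _ => (nonAdj_symm R col y x).1)
    (eCount_mono fun x _ y _ => (nonAdj_symm R col y x).2)

open Classical in
theorem core {V : Type*} (R : V → V → Prop) (col : V → Prop)
    (hb : ∀ u v, R u v → ¬ (col u ↔ col v)) (ho : ∀ u v, R u v → ¬ R v u)
    (h4 : ∀ a b c d, R a b → R b c → R c d → R d a → False)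
    (T : Finset V) (hT : T.Nontrivial)
    (hs : ∑ v ∈ T, eCount (firstRel R T v) T T ≤ ∑ v ∈ T, eCount (secRel R T v) T T) :
    ∃ S, S ⊂ T ∧ S.Nonempty ∧ eCount R S (T \ S) ≤ eCount (NonAdj R col) S (T \ S) := by
  obtain ⟨v, hv, hle⟩ := Finset.exists_le_of_sum_le hT.nonempty hs
  by_cases hsink : ∀ b ∈ T, ¬ R v b
  · refine ⟨{v}, ?_, by simp, ?_⟩
    · obtain ⟨w, hw, hne⟩ := hT.exists_ne v
      rw [Finset.ssubset_iff_subset_ne]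
      refine ⟨by simpa using hv, ?_⟩
      rintro rfl
      simp at hw
      exact hne hw
    · rw [eCount_zero]
      · simp
      · intro x hx y hy
        simp at hx hy
        subst hx
        exact hsink y hy.1
  · push Not at hsink
    obtain ⟨b0, hb0, hvb0⟩ := hsink
    set S : Finset V := T.filter (fun x => R v x ∨ ∃ b ∈ T, R v b ∧ R b x) with hS
    have hST : S ⊆ T := Finset.filter_subset _ _
    refine ⟨S, ?_, ⟨b0, by simp [hS, hb0, hvb0]⟩, ?_⟩
    · refine (Finset.ssubset_iff_of_subset hST).2 ⟨v, hv, ?_⟩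
      simp only [hS, Finset.mem_filter, not_and, not_or]
      intro _
      refine ⟨fun h => hb v v h Iff.rfl, ?_⟩
      rintro ⟨b, _, h1, h2⟩
      exact ho _ _ h1 h2
    · have h1 : eCount R S (T \ S) ≤ eCount (firstRel R T v) T T := by
        rw [eCount_split _ hST]
        have : eCount R S (T \ S) ≤ eCount (firstRel R T v) S (T \ S) := by
          apply eCount_mono
          intro c hc d hd hcd
          simp only [hS, Finset.mem_sdiff, Finset.mem_filter, not_and, not_or] at hc hd
          obtain ⟨hcT, hc⟩ := hc
          obtain ⟨hdT, hd⟩ := hd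
          obtain ⟨hd1, hd2⟩ := hd hdT
          rcases hc with hc | ⟨b, hbT, hvb, hbc⟩
          · exact absurd ⟨c, hcT, hc, hcd⟩ hd2
          · exact ⟨b, hbT, hvb, hbc, hcd, hd1, fun h => h4 _ _ _ _ hvb hbc hcd h⟩
        omega
      have h2 : eCount (secRel R T v) T T ≤ eCount (NonAdj R col) S (T \ S) := by
        have key : ∀ a ∈ T, ∀ d ∈ T, secRel R T v a d →
            a ∈ T \ S ∧ d ∈ S ∧ NonAdj R col d a := by
          rintro a ha d hd ⟨c, hc, hav, hvc, hcd, h5, h6⟩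
          have e1 := hb _ _ hav
          have e2 := hb _ _ hvc
          have e3 := hb _ _ hcd
          refine ⟨?_, ?_, ?_, h6, h5⟩
          · simp only [hS, Finset.mem_sdiff, Finset.mem_filter, not_and, not_or]
            refine ⟨ha, fun _ => ⟨ho _ _ hav, ?_⟩⟩
            rintro ⟨b, _, hvb, hba⟩
            have e4 := hb _ _ hvb
            have e5 := hb _ _ hba
            tauto
          · simp only [hS, Finset.mem_filter]
            exact ⟨hd, Or.inr ⟨c, hc, hvc, hcd⟩⟩
          · tauto
        rw [eCount_nonAdj_swap, eCount_split _ hST]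
        rw [eCount_zero (S := S) (S' := S), eCount_zero (S := S) (S' := T \ S),
          eCount_zero (S := T \ S) (S' := T \ S)]
        · simp only [zero_add, add_zero]
          apply eCount_mono
          intro a ha d hd h
          exact (nonAdj_symm R col _ _).1 (key a (Finset.mem_sdiff.1 ha).1 d (hST hd) h).2.2
        · intro a ha d hd h
          exact (Finset.mem_sdiff.1 hd).2
            (key a (Finset.mem_sdiff.1 ha).1 d (Finset.mem_sdiff.1 hd).1 h).2.1
        · intro a ha d hd h
          exact (Finset.mem_sdiff.1 (key a (hST ha) d (Finset.mem_sdiff.1 hd).1 h).1).2 ha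
        · intro a ha d hd h
          exact (Finset.mem_sdiff.1 (key a (hST ha) d (hST hd) h).1).2 ha
      exact h1.trans (hle.trans h2)

open Classical in
theorem core2 {V : Type*} (R : V → V → Prop) (col : V → Prop)
    (hb : ∀ u v, R u v → ¬ (col u ↔ col v)) (ho : ∀ u v, R u v → ¬ R v u)
    (h4 : ∀ a b c d, R a b → R b c → R c d → R d a → False)
    (T : Finset V) (hT : T.Nontrivial) :
    ∃ S, S ⊂ T ∧ S.Nonempty ∧ eCount R S (T \ S) ≤ eCount (NonAdj R col) S (T \ S) := by
  rcases le_total (∑ v ∈ T, eCount (firstRel R T v) T T)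
    (∑ v ∈ T, eCount (secRel R T v) T T) with h | h
  · exact core R col hb ho h4 T hT h
  · have h' := h
    rw [← sum_rev R] at h'
    have h'' := sum_rev (fun x y => R y x) T
    replace h' := h'.trans h''.le
    obtain ⟨S, hST, hS, hle⟩ := core (fun x y => R y x) col
      (fun u v h => fun e => hb v u h e.symm) (fun u v h => ho v u h)
      (fun a b c d h1 h2 h3 h5 => h4 d c b a h3 h2 h1 h5) T hT h'
    refine ⟨T \ S, ?_, ?_, ?_⟩
    · exact Finset.sdiff_ssubset hST.1 hS
    · exact Finset.sdiff_nonempty.2 hST.2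
    · rw [Finset.sdiff_sdiff_eq_self hST.1, ← eCount_swap, eCount_nonAdj_swap]
      refine hle.trans (eCount_mono ?_)
      unfold NonAdj
      tauto

theorem ranking {V : Type*} (R : V → V → Prop) (col : V → Prop)
    (hb : ∀ u v, R u v → ¬ (col u ↔ col v)) (ho : ∀ u v, R u v → ¬ R v u)
    (h4 : ∀ a b c d, R a b → R b c → R c d → R d a → False)
    (T : Finset V) :
    ∃ r : V → ℕ, 2 * eCount (fun x y => R x y ∧ r y ≤ r x) T T
      ≤ eCount (NonAdj R col) T T := by
  classical
  induction T using Finset.strongInduction with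
  | H T ih =>
  by_cases hT : T.Nontrivial
  · obtain ⟨S, hST, hS, hle⟩ := core2 R col hb ho h4 T hT
    obtain ⟨r1, h1⟩ := ih S hST
    obtain ⟨r2, h2⟩ := ih (T \ S) (Finset.sdiff_ssubset hST.1 hS)
    refine ⟨fun x => if x ∈ S then r1 x + (T.sup r2 + 1) else r2 x, ?_⟩
    rw [eCount_split _ hST.1, eCount_split (NonAdj R col) hST.1,
      eCount_nonAdj_swap R col (T \ S) S]
    beta_reduce
    have a1 : eCount (fun x y => R x y ∧
        (if y ∈ S then r1 y + (T.sup r2 + 1) else r2 y) ≤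
        (if x ∈ S then r1 x + (T.sup r2 + 1) else r2 x)) S S ≤
        eCount (fun x y => R x y ∧ r1 y ≤ r1 x) S S := by
      apply eCount_mono
      intro x hx y hy h
      simpa [hx, hy] using h
    have a2 : eCount (fun x y => R x y ∧
        (if y ∈ S then r1 y + (T.sup r2 + 1) else r2 y) ≤
        (if x ∈ S then r1 x + (T.sup r2 + 1) else r2 x)) (T \ S) (T \ S) ≤
        eCount (fun x y => R x y ∧ r2 y ≤ r2 x) (T \ S) (T \ S) := by
      apply eCount_mono
      intro x hx y hy h
      rw [if_neg (Finset.mem_sdiff.1 hx).2, if_neg (Finset.mem_sdiff.1 hy).2] at h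
      exact h
    have a3 : eCount (fun x y => R x y ∧
        (if y ∈ S then r1 y + (T.sup r2 + 1) else r2 y) ≤
        (if x ∈ S then r1 x + (T.sup r2 + 1) else r2 x)) (T \ S) S = 0 := by
      apply eCount_zero
      intro x hx y hy h
      rw [if_neg (Finset.mem_sdiff.1 hx).2, if_pos hy] at h
      have := Finset.le_sup (f := r2) (Finset.mem_sdiff.1 hx).1
      omega
    have a4 : eCount (fun x y => R x y ∧
        (if y ∈ S then r1 y + (T.sup r2 + 1) else r2 y) ≤
        (if x ∈ S then r1 x + (T.sup r2 + 1) else r2 x)) S (T \ S) ≤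
        eCount R S (T \ S) := by
      apply eCount_mono
      intro x hx y hy h
      exact h.1
    omega
  · refine ⟨fun _ => 0, ?_⟩
    rw [eCount_zero]
    · simp
    · intro x hx y hy h
      have : x = y := by
        by_contra hne
        exact hT ⟨x, hx, y, hy, hne⟩
      subst this
      exact hb _ _ h.1 Iff.rfl

/-- a finite bipartite digraph (at most one of `(u,v)`, `(v,u)` being an arc for
distinct `u ∈ X`, `v ∈ Y`) with no 4-cycles has a feedback arc set of size at most `Λ(D)`. -/
theorem stmt_4 {V : Type*} [Fintype V] (A : Set (V × V)) (X Y : Set V)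
    (hV : X ∪ Y = Set.univ) (hXY : Disjoint X Y)
    (hbip : ∀ p ∈ A, (p.1 ∈ X ∧ p.2 ∈ Y) ∨ (p.1 ∈ Y ∧ p.2 ∈ X))
    (horient : ∀ u ∈ X, ∀ v ∈ Y, u ≠ v → ¬((u, v) ∈ A ∧ (v, u) ∈ A))
    (h4 : ¬ ∃ l : List V, IsCycleIn A l ∧ l.length = 4) :
    ∃ F : Set (V × V), IsFAS A F ∧ F.ncard ≤ Lambda A X Y := by
  classical
  have hY : ∀ v, v ∈ Y ↔ v ∉ X := by
    intro v
    constructor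
    · intro h h'
      exact Set.disjoint_left.1 hXY h' h
    · intro h
      have : v ∈ X ∪ Y := by rw [hV]; trivial
      exact this.resolve_left h
  have hb : ∀ u v, (u, v) ∈ A → ¬ (u ∈ X ↔ v ∈ X) := by
    intro u v h
    have := hbip _ h
    simp only [hY] at this
    tauto
  have ho : ∀ u v, (u, v) ∈ A → ¬ (v, u) ∈ A := by
    intro u v h h'
    have hne : u ≠ v := by
      rintro rfl
      exact hb _ _ h Iff.rfl
    rcases hbip _ h with ⟨h1, h2⟩ | ⟨h1, h2⟩
    · exact horient u h1 v h2 hne ⟨h, h'⟩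
    · exact horient v h2 u h1 hne.symm ⟨h', h⟩
  have hne : ∀ u v, (u, v) ∈ A → u ≠ v := by
    rintro u v h rfl
    exact hb _ _ h Iff.rfl
  obtain ⟨r, hr⟩ := ranking (fun x y => (x, y) ∈ A) (fun x => x ∈ X) hb ho (by
    intro a b c d h1 h2 h3 h5
    apply h4
    refine ⟨[a, b, c, d], ⟨?_, by simp, ?_⟩, rfl⟩
    · have hac : a ≠ c := by
        rintro rfl
        exact ho _ _ h1 h2
      have hbd : b ≠ d := by
        rintro rfl
        exact ho _ _ h2 h3
      have := hne _ _ h1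
      have := hne _ _ h2
      have := hne _ _ h3
      have := (hne _ _ h5).symm
      simp [*]
    · intro i
      change Fin 4 at i
      fin_cases i
      · exact h1
      · exact h2
      · exact h3
      · simpa using h5) Finset.univ
  refine ⟨{p | p ∈ A ∧ r p.2 ≤ r p.1}, ⟨fun p hp => hp.1, ?_⟩, ?_⟩
  · rintro l ⟨_, hl, hc⟩
    haveI : Nonempty (Fin l.length) := ⟨⟨0, by omega⟩⟩
    obtain ⟨i, hi⟩ := Finite.exists_max (fun i : Fin l.length => r (l.get i))
    have h1 := hc i
    have h2 := hi ⟨(i.1 + 1) % l.length, Nat.mod_lt _ i.pos⟩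
    exact h1.2 ⟨h1.1, h2⟩
  · rw [eCount_card] at hr
    simp only [Finset.mem_univ, true_and] at hr
    have hN : eCount (NonAdj (fun x y => (x, y) ∈ A) (fun x => x ∈ X)) Finset.univ Finset.univ
        = 2 * Lambda A X Y := by
      rw [eCount_card]
      have hu : {p : V × V | p.1 ∈ (Finset.univ : Finset V) ∧ p.2 ∈ (Finset.univ : Finset V) ∧
          NonAdj (fun x y => (x, y) ∈ A) (fun x => x ∈ X) p.1 p.2} =
          {p : V × V | p.1 ∈ X ∧ p.2 ∈ Y ∧ (p.1, p.2) ∉ A ∧ (p.2, p.1) ∉ A} ∪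
          Prod.swap '' {p : V × V | p.1 ∈ X ∧ p.2 ∈ Y ∧ (p.1, p.2) ∉ A ∧ (p.2, p.1) ∉ A} := by
        ext ⟨x, y⟩
        simp only [NonAdj, Set.image_swap_eq_preimage_swap, Set.mem_union, Set.mem_preimage,
          Set.mem_setOf_eq, Finset.mem_univ, true_and, hY, Prod.fst_swap, Prod.snd_swap]
        tauto
      rw [hu, Set.ncard_union_eq, Set.ncard_image_of_injective _ Prod.swap_injective]
      · unfold Lambda
        ring
      · rw [Set.disjoint_left]
        rintro ⟨x, y⟩ h1 h2
        simp only [Set.image_swap_eq_preimage_swap, Set.mem_preimage,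
          Set.mem_setOf_eq, hY, Prod.fst_swap, Prod.snd_swap] at h1 h2
        tauto
    rw [hN] at hr
    have : {p : V × V | p ∈ A ∧ r p.2 ≤ r p.1} = {p : V × V | (p.1, p.2) ∈ A ∧ r p.2 ≤ r p.1} := rfl
    rw [this]
    omega
end

section
/- For every non-negative integer k, every finite bipartite tournament T either contains k pairwise arc-disjoint 4-cycles or has a feedback arc set of size at most 7(k−1). -/
variable {V : Type*}

open Classical in
/-- Split lemma, given that the number of first classes is at most that of second classes. -/
theorem split_aux {V : Type*} (E : V → V → Prop) (col : V → Bool)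
    (hcol : ∀ u v, E u v → col u ≠ col v)
    (h4 : ∀ a b c d, E a b → E b c → E c d → E d a → False)
    (S : Finset V) (hS : 2 ≤ S.card)
    (hle : (∑ v ∈ S, ((S ×ˢ S).filter (fun p => (col v ≠ col p.2 ∧ ¬ E v p.2 ∧ ¬ E p.2 v) ∧
        ∃ b ∈ S, E v b ∧ E b p.1 ∧ E p.1 p.2)).card) ≤
      ∑ v ∈ S, ((S ×ˢ S).filter (fun p => (col p.1 ≠ col p.2 ∧ ¬ E p.1 p.2 ∧ ¬ E p.2 p.1) ∧
        ∃ c ∈ S, E p.1 v ∧ E v c ∧ E c p.2)).card) :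
    ∃ L R : Finset V, L.Nonempty ∧ R.Nonempty ∧ Disjoint L R ∧ L ∪ R = S ∧
      ((L ×ˢ R).filter (fun p => E p.1 p.2)).card ≤
      ((L ×ˢ R).filter (fun p => col p.1 ≠ col p.2 ∧ ¬ E p.1 p.2 ∧ ¬ E p.2 p.1)).card := by
  have hne : S.Nonempty := by
    rw [← Finset.card_pos]; omega
  obtain ⟨v, hv, hvle⟩ := Finset.exists_le_of_sum_le hne hle
  by_cases hout : ∃ b ∈ S, E v b
  · obtain ⟨b₀, hb₀S, hb₀⟩ := hout
    refine ⟨S.filter (fun w => E v w ∨ ∃ b ∈ S, E v b ∧ E b w),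
      S.filter (fun w => ¬ (E v w ∨ ∃ b ∈ S, E v b ∧ E b w)), ⟨b₀, ?_⟩, ⟨v, ?_⟩, ?_, ?_, ?_⟩
    · simp [hb₀S, hb₀]
    · simp only [Finset.mem_filter, hv, true_and]
      rintro (h | ⟨b, -, h1, h2⟩)
      · exact hcol _ _ h rfl
      · exact h4 _ _ _ _ h1 h2 h1 h2
    · exact Finset.disjoint_filter_filter_not _ _ _
    · exact Finset.filter_union_filter_not_eq _ _
    · refine le_trans (Finset.card_le_card ?_) (hvle.trans ?_)
      · rintro ⟨c, d⟩ h
        simp only [Finset.mem_filter, Finset.mem_product] at h ⊢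
        obtain ⟨⟨⟨hc, hc'⟩, hd, hd'⟩, hE⟩ := h
        push Not at hd'
        refine ⟨⟨hc, hd⟩, ?_⟩
        rcases hc' with hc' | ⟨b, hb, h1, h2⟩
        · exact absurd hE (hd'.2 c hc hc')
        · refine ⟨⟨?_, hd'.1, fun h => h4 _ _ _ _ h1 h2 hE h⟩, b, hb, h1, h2, hE⟩
          have e1 := hcol _ _ h1
          have e2 := hcol _ _ h2
          have e3 := hcol _ _ hE
          revert e1 e2 e3
          cases col v <;> cases col b <;> cases col c <;> cases col d <;> simp
      · refine Finset.card_le_card_of_injOn Prod.swap ?_ (Prod.swap_injective.injOn)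
        rintro ⟨a, d⟩ h
        simp only [Finset.coe_filter, Set.mem_ofPred_eq, Finset.mem_filter, Finset.mem_product,
          Prod.swap] at h ⊢
        obtain ⟨⟨ha, hd⟩, ⟨hc, n1, n2⟩, c, hcS, e1, e2, e3⟩ := h
        refine ⟨⟨⟨hd, Or.inr ⟨c, hcS, e2, e3⟩⟩, ha, ?_⟩, hc.symm, n2, n1⟩
        rintro (h | ⟨b, -, h1, h2⟩)
        · exact h4 _ _ _ _ h e1 h e1
        · have e1 := hcol _ _ e1
          have e2 := hcol _ _ h1
          have e3 := hcol _ _ h2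
          revert e1 e2 e3
          cases col v <;> cases col b <;> cases col a <;> simp
  · push Not at hout
    refine ⟨{v}, S.erase v, by simp, ?_, by simp, ?_, ?_⟩
    · rw [← Finset.card_pos, Finset.card_erase_of_mem hv]; omega
    · ext w; by_cases h : w = v <;> simp [h, hv]
    · rw [Finset.card_eq_zero.2]
      · exact Nat.zero_le _
      · ext ⟨a, b⟩
        simp only [Finset.mem_filter, Finset.mem_product, Finset.mem_singleton, Finset.mem_erase,
          Finset.notMem_empty, iff_false]
        rintro ⟨⟨rfl, -, h⟩, h'⟩
        exact hout _ h h'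

open Classical in
/-- A sum of fibre counts as the size of a set of triples. -/
theorem sum_card_triples {V : Type*} (S : Finset V) (P : V → V × V → Prop)
    [∀ v, DecidablePred (P v)] :
    ∑ v ∈ S, ((S ×ˢ S).filter (P v)).card =
      ((S ×ˢ (S ×ˢ S)).filter (fun t => P t.1 t.2)).card := by
  rw [Finset.card_filter, Finset.sum_product]
  exact Finset.sum_congr rfl fun v _ => Finset.card_filter _ _

open Classical in
theorem split_main {V : Type*} (E : V → V → Prop) (col : V → Bool)
    (hcol : ∀ u v, E u v → col u ≠ col v)
    (h4 : ∀ a b c d, E a b → E b c → E c d → E d a → False)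
    (S : Finset V) (hS : 2 ≤ S.card) :
    ∃ L R : Finset V, L.Nonempty ∧ R.Nonempty ∧ Disjoint L R ∧ L ∪ R = S ∧
      ((L ×ˢ R).filter (fun p => E p.1 p.2)).card ≤
      ((L ×ˢ R).filter (fun p => col p.1 ≠ col p.2 ∧ ¬ E p.1 p.2 ∧ ¬ E p.2 p.1)).card := by
  rcases le_total (∑ v ∈ S, ((S ×ˢ S).filter (fun p => (col v ≠ col p.2 ∧ ¬ E v p.2 ∧ ¬ E p.2 v) ∧
        ∃ b ∈ S, E v b ∧ E b p.1 ∧ E p.1 p.2)).card)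
      (∑ v ∈ S, ((S ×ˢ S).filter (fun p => (col p.1 ≠ col p.2 ∧ ¬ E p.1 p.2 ∧ ¬ E p.2 p.1) ∧
        ∃ c ∈ S, E p.1 v ∧ E v c ∧ E c p.2)).card) with h | h
  · exact split_aux E col hcol h4 S hS h
  · have := split_aux (fun u v => E v u) col (fun u v h => (hcol _ _ h).symm)
      (fun a b c d h1 h2 h3 h5 => h4 _ _ _ _ h3 h2 h1 h5) S hS ?_
    · obtain ⟨L, R, hL, hR, hd, hu, hle⟩ := this
      refine ⟨R, L, hR, hL, hd.symm, by rw [Finset.union_comm]; exact hu, ?_⟩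
      refine le_trans ?_ (hle.trans ?_)
      · refine Finset.card_le_card_of_injOn Prod.swap ?_ (Prod.swap_injective.injOn)
        rintro ⟨a, d⟩ h
        simp only [Finset.coe_filter, Set.mem_ofPred_eq, Finset.mem_product, Prod.swap] at h ⊢
        tauto
      · refine Finset.card_le_card_of_injOn Prod.swap ?_ (Prod.swap_injective.injOn)
        rintro ⟨a, d⟩ h
        simp only [Finset.coe_filter, Set.mem_ofPred_eq, Finset.mem_product, Prod.swap] at h ⊢
        obtain ⟨⟨h1, h2⟩, h3, h4, h5⟩ := h
        exact ⟨⟨h2, h1⟩, h3.symm, h4, h5⟩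
    · refine le_trans ?_ (h.trans ?_)
      · rw [sum_card_triples S (fun v p => (col v ≠ col p.2 ∧ ¬ E p.2 v ∧ ¬ E v p.2) ∧
          ∃ b ∈ S, E b v ∧ E p.1 b ∧ E p.2 p.1),
          sum_card_triples S (fun v p => (col p.1 ≠ col p.2 ∧ ¬ E p.1 p.2 ∧ ¬ E p.2 p.1) ∧
          ∃ c ∈ S, E p.1 v ∧ E v c ∧ E c p.2)]
        refine Finset.card_le_card_of_injOn (fun t => (t.2.1, t.2.2, t.1)) ?_ ?_
        · rintro ⟨a, c, d⟩ h
          simp only [Finset.coe_filter, Set.mem_ofPred_eq, Finset.mem_product] at h ⊢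
          obtain ⟨⟨h1, h2, h3⟩, ⟨h5, h6, h7⟩, b, hb, h8, h9, h10⟩ := h
          exact ⟨⟨h2, h3, h1⟩, ⟨h5.symm, h6, h7⟩, b, hb, h10, h9, h8⟩
        · rintro ⟨a, c, d⟩ - ⟨a', c', d'⟩ - h
          simp only [Prod.mk.injEq] at h ⊢
          tauto
      · rw [sum_card_triples S (fun v p => (col p.1 ≠ col p.2 ∧ ¬ E p.2 p.1 ∧ ¬ E p.1 p.2) ∧
          ∃ c ∈ S, E v p.1 ∧ E c v ∧ E p.2 c),
          sum_card_triples S (fun v p => (col v ≠ col p.2 ∧ ¬ E v p.2 ∧ ¬ E p.2 v) ∧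
          ∃ b ∈ S, E v b ∧ E b p.1 ∧ E p.1 p.2)]
        refine Finset.card_le_card_of_injOn (fun t => (t.2.1, t.2.2, t.1)) ?_ ?_
        · rintro ⟨a, c, d⟩ h
          simp only [Finset.coe_filter, Set.mem_ofPred_eq, Finset.mem_product] at h ⊢
          obtain ⟨⟨h1, h2, h3⟩, ⟨h5, h6, h7⟩, b, hb, h8, h9, h10⟩ := h
          exact ⟨⟨h2, h3, h1⟩, ⟨h5.symm, h6, h7⟩, b, hb, h10, h9, h8⟩
        · rintro ⟨a, c, d⟩ - ⟨a', c', d'⟩ - h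
          simp only [Prod.mk.injEq] at h ⊢
          tauto

open Classical in
theorem exists_rank {V : Type*} (E : V → V → Prop) (col : V → Bool)
    (hcol : ∀ u v, E u v → col u ≠ col v)
    (h4 : ∀ a b c d, E a b → E b c → E c d → E d a → False) :
    ∀ (n : ℕ) (S : Finset V), S.card = n → ∃ r : V → ℕ, Set.InjOn r S ∧
      2 * ((S ×ˢ S).filter (fun p => E p.1 p.2 ∧ r p.2 < r p.1)).card ≤
      ((S ×ˢ S).filter (fun p => col p.1 ≠ col p.2 ∧ ¬ E p.1 p.2 ∧ ¬ E p.2 p.1)).card := by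
  intro n
  induction n using Nat.strong_induction_on with
  | _ n ih =>
    intro S hn
    by_cases hS : 2 ≤ S.card
    · obtain ⟨L, R, hL, hR, hd, hu, hle⟩ := split_main E col hcol h4 S hS
      have hcard : L.card + R.card = n := by
        rw [← Finset.card_union_of_disjoint hd, hu, hn]
      have hLp := hL.card_pos
      have hRp := hR.card_pos
      obtain ⟨rL, iL, bL⟩ := ih L.card (by omega) L rfl
      obtain ⟨rR, iR, bR⟩ := ih R.card (by omega) R rfl
      have hRL : ∀ w ∈ R, w ∉ L := fun w hw hw' => Finset.disjoint_left.1 hd hw' hw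
      have hb : ∀ w ∈ R, rR w < R.sup rR + 1 := fun w hw => Nat.lt_succ_of_le (Finset.le_sup hw)
      set M := R.sup rR + 1 with hM
      let r : V → ℕ := fun w => if w ∈ L then M + rL w else rR w
      have r1 : ∀ w ∈ L, r w = M + rL w := fun w hw => if_pos hw
      have r2 : ∀ w ∈ R, r w = rR w := fun w hw => if_neg (hRL w hw)
      refine ⟨r, ?_, ?_⟩
      · intro a ha b hb' hab
        rw [Finset.mem_coe, ← hu, Finset.mem_union] at ha hb'
        rcases ha with ha | ha <;> rcases hb' with hb' | hb'
        · rw [r1 a ha, r1 b hb'] at hab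
          exact iL ha hb' (by omega)
        · rw [r1 a ha, r2 b hb'] at hab
          have := hb b hb'
          omega
        · rw [r2 a ha, r1 b hb'] at hab
          have := hb a ha
          omega
        · rw [r2 a ha, r2 b hb'] at hab
          exact iR ha hb' hab
      · have up : ((S ×ˢ S).filter (fun p => E p.1 p.2 ∧ r p.2 < r p.1)) ⊆
            ((L ×ˢ L).filter (fun p => E p.1 p.2 ∧ rL p.2 < rL p.1)) ∪
            ((R ×ˢ R).filter (fun p => E p.1 p.2 ∧ rR p.2 < rR p.1)) ∪
            ((L ×ˢ R).filter (fun p => E p.1 p.2)) := by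
          rintro ⟨a, b⟩ h
          simp only [Finset.mem_filter, Finset.mem_product, Finset.mem_union, ← hu] at h ⊢
          obtain ⟨⟨ha, hb'⟩, hE, hr⟩ := h
          rcases ha with ha | ha <;> rcases hb' with hb' | hb'
          · rw [r1 a ha, r1 b hb'] at hr
            exact Or.inl (Or.inl ⟨⟨ha, hb'⟩, hE, by omega⟩)
          · exact Or.inr ⟨⟨ha, hb'⟩, hE⟩
          · rw [r2 a ha, r1 b hb'] at hr
            have := hb a ha
            omega
          · rw [r2 a ha, r2 b hb'] at hr
            exact Or.inl (Or.inr ⟨⟨ha, hb'⟩, hE, by omega⟩)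
        have up' := (Finset.card_le_card up).trans ((Finset.card_union_le _ _).trans
          (Nat.add_le_add_right (Finset.card_union_le _ _) _))
        have hsw : ((L ×ˢ R).filter
              (fun p => col p.1 ≠ col p.2 ∧ ¬ E p.1 p.2 ∧ ¬ E p.2 p.1)).card ≤
            ((R ×ˢ L).filter
              (fun p => col p.1 ≠ col p.2 ∧ ¬ E p.1 p.2 ∧ ¬ E p.2 p.1)).card := by
          refine Finset.card_le_card_of_injOn Prod.swap ?_ (Prod.swap_injective.injOn)
          rintro ⟨a, d⟩ h
          simp only [Finset.coe_filter, Set.mem_ofPred_eq, Finset.mem_product, Prod.swap] at h ⊢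
          obtain ⟨⟨h1, h2⟩, h3, h4, h5⟩ := h
          exact ⟨⟨h2, h1⟩, h3.symm, h5, h4⟩
        have hsum : ((S ×ˢ S).filter
              (fun p => col p.1 ≠ col p.2 ∧ ¬ E p.1 p.2 ∧ ¬ E p.2 p.1)).card =
            ((L ×ˢ L).filter (fun p => col p.1 ≠ col p.2 ∧ ¬ E p.1 p.2 ∧ ¬ E p.2 p.1)).card +
            ((L ×ˢ R).filter (fun p => col p.1 ≠ col p.2 ∧ ¬ E p.1 p.2 ∧ ¬ E p.2 p.1)).card +
            (((R ×ˢ L).filter (fun p => col p.1 ≠ col p.2 ∧ ¬ E p.1 p.2 ∧ ¬ E p.2 p.1)).card +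
            ((R ×ˢ R).filter (fun p => col p.1 ≠ col p.2 ∧ ¬ E p.1 p.2 ∧ ¬ E p.2 p.1)).card) := by
          simp only [Finset.card_filter, Finset.sum_product]
          rw [← hu, Finset.sum_union hd]
          simp only [Finset.sum_union hd, Finset.sum_add_distrib]
        omega
    · refine ⟨fun _ => 0, ?_, by simp⟩
      intro a ha b hb _
      exact Finset.card_le_one.1 (by omega) a ha b hb

theorem exists_rank_univ {V : Type*} [Fintype V] (E : V → V → Prop) (col : V → Bool)
    (hcol : ∀ u v, E u v → col u ≠ col v)
    (h4 : ∀ a b c d, E a b → E b c → E c d → E d a → False) :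
    ∃ r : V → ℕ, Function.Injective r ∧
      2 * {p : V × V | E p.1 p.2 ∧ r p.2 < r p.1}.ncard ≤
      {p : V × V | col p.1 ≠ col p.2 ∧ ¬ E p.1 p.2 ∧ ¬ E p.2 p.1}.ncard := by
  classical
  obtain ⟨r, hi, h⟩ := exists_rank E col hcol h4 _ Finset.univ rfl
  refine ⟨r, fun a b hab => hi (by simp) (by simp) hab, ?_⟩
  rw [← Set.ncard_coe_finset, ← Set.ncard_coe_finset] at h
  simpa using h

theorem cycleArcs_four {V : Type*} (a b c d : V) :
    cycleArcs [a, b, c, d] = {(a, b), (b, c), (c, d), (d, a)} := by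
  ext p
  simp only [cycleArcs, Set.mem_ofPred_eq, Set.mem_insert_iff, Set.mem_singleton_iff]
  constructor
  · rintro ⟨⟨i, hi⟩, rfl⟩
    simp only [List.length_cons, List.length_nil] at hi
    interval_cases i <;> simp
  · rintro (rfl | rfl | rfl | rfl)
    · exact ⟨⟨0, by simp⟩, rfl⟩
    · exact ⟨⟨1, by simp⟩, rfl⟩
    · exact ⟨⟨2, by simp⟩, rfl⟩
    · exact ⟨⟨3, by simp⟩, by simp⟩

theorem cycleArcs_card {V : Type*} (l : List V) (hl : l.length = 4) :
    (cycleArcs l).Finite ∧ (cycleArcs l).ncard ≤ 4 := by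
  match l, hl with
  | [a, b, c, d], _ =>
    rw [cycleArcs_four]
    refine ⟨by simp, ?_⟩
    refine (Set.ncard_insert_le _ _).trans ?_
    have h1 := Set.ncard_insert_le (b, c) {(c, d), (d, a)}
    have h2 := Set.ncard_insert_le (c, d) {(d, a)}
    rw [Set.ncard_singleton] at h2
    omega

theorem cycle_back_card {V : Type*} (r : V → ℕ) (l : List V) (hl : l.length = 4) :
    {p ∈ cycleArcs l | r p.2 < r p.1}.ncard ≤ 3 := by
  obtain ⟨hf, h4⟩ := cycleArcs_card l hl
  have hlt : {p ∈ cycleArcs l | r p.2 < r p.1} ⊂ cycleArcs l := by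
    refine ⟨fun p hp => hp.1, fun hsub => ?_⟩
    match l, hl with
    | [a, b, c, d], _ =>
      rw [cycleArcs_four] at hsub
      have h1 := (hsub (show (a, b) ∈ _ by simp)).2
      have h2 := (hsub (show (b, c) ∈ _ by simp)).2
      have h3 := (hsub (show (c, d) ∈ _ by simp)).2
      have h5 := (hsub (show (d, a) ∈ _ by simp)).2
      simp only at h1 h2 h3 h5
      omega
  have := Set.ncard_lt_ncard hlt hf
  omega

theorem acyclic_of_rank {V : Type*} (B : Set (V × V)) (r : V → ℕ)
    (h : ∀ p ∈ B, r p.1 < r p.2) : Acyclic B := by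
  rintro l ⟨-, hlen, hl⟩
  have : Nonempty (Fin l.length) := ⟨⟨0, by omega⟩⟩
  obtain ⟨i, hi⟩ := Finite.exists_max (fun i : Fin l.length => r (l.get i))
  have h1 := h _ (hl i)
  have h2 := hi ⟨(i.1 + 1) % l.length, Nat.mod_lt _ i.pos⟩
  simp only at h1 h2
  omega

/-- for every `k`, every finite bipartite tournament contains `k` pairwise
arc-disjoint 4-cycles or has a feedback arc set of size at most `7(k-1)`. -/
theorem stmt_5 {V : Type*} [Fintype V] (A : Set (V × V)) (X Y : Set V)
    (hV : X ∪ Y = Set.univ) (hXY : Disjoint X Y)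
    (htour : ∀ u ∈ X, ∀ v ∈ Y, ((u, v) ∈ A ↔ (v, u) ∉ A))
    (hnoXX : ∀ u ∈ X, ∀ v ∈ X, (u, v) ∉ A) (hnoYY : ∀ u ∈ Y, ∀ v ∈ Y, (u, v) ∉ A)
    (k : ℕ) :
    (∃ f : Fin k → List V,
        (∀ i, IsCycleIn A (f i) ∧ (f i).length = 4) ∧
        (∀ i j, i ≠ j → Disjoint (cycleArcs (f i)) (cycleArcs (f j)))) ∨
    (∃ F : Set (V × V), IsFAS A F ∧ F.ncard ≤ 7 * (k - 1)) := by
  classical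
  set P : ℕ → Prop := fun k => ∃ f : Fin k → List V,
        (∀ i, IsCycleIn A (f i) ∧ (f i).length = 4) ∧
        (∀ i j, i ≠ j → Disjoint (cycleArcs (f i)) (cycleArcs (f j))) with hP
  by_cases hk : P k
  · exact Or.inl hk
  right
  have hP0 : P 0 := ⟨fun i => i.elim0, fun i => i.elim0, fun i => i.elim0⟩
  obtain ⟨m, hmk, ⟨f, hf, hdis⟩, hm1⟩ : ∃ m, m < k ∧ P m ∧ ¬ P (m + 1) := by
    by_contra hcon
    push Not at hcon
    have : ∀ n, n ≤ k → P n := by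
      intro n
      induction n with
      | zero => exact fun _ => hP0
      | succ n ih => exact fun h => hcon n (by omega) (ih (by omega))
    exact hk (this k le_rfl)
  have hmem : ∀ w, w ∈ X ∨ w ∈ Y := fun w => by
    have : w ∈ X ∪ Y := hV ▸ Set.mem_univ w
    exact this
  have hnot : ∀ w, w ∈ X → w ∉ Y := fun w hx hy => Set.disjoint_left.1 hXY hx hy
  let col : V → Bool := fun w => decide (w ∈ X)
  have hcolA : ∀ u v, (u, v) ∈ A → col u ≠ col v := by
    intro u v h
    simp only [col, ne_eq, decide_eq_decide]
    intro hiff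
    by_cases hu : u ∈ X
    · exact hnoXX u hu v (hiff.1 hu) h
    · exact hnoYY u ((hmem u).resolve_left hu) v
        ((hmem v).resolve_left (fun hv => hu (hiff.2 hv))) h
  have hasym : ∀ u v, (u, v) ∈ A → (v, u) ∉ A := by
    intro u v h h'
    rcases hmem u with hu | hu <;> rcases hmem v with hv | hv
    · exact hnoXX u hu v hv h
    · exact (htour u hu v hv).1 h h'
    · exact (htour v hv u hu).1 h' h
    · exact hnoYY u hu v hv h
  have htot : ∀ u v, col u ≠ col v → (u, v) ∈ A ∨ (v, u) ∈ A := by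
    intro u v h
    simp only [col, ne_eq, decide_eq_decide] at h
    rcases hmem u with hu | hu <;> rcases hmem v with hv | hv
    · exact absurd (by simp [hu, hv]) h
    · have := htour u hu v hv
      tauto
    · have := htour v hv u hu
      tauto
    · exact absurd (by exact iff_of_false (fun h => hnot u h hu) (fun h => hnot v h hv)) h
  have hne : ∀ u v, (u, v) ∈ A → u ≠ v := fun u v h e => hcolA u v h (by rw [e])
  set Del : Set (V × V) := ⋃ i, cycleArcs (f i) with hDel
  let E : V → V → Prop := fun u v => (u, v) ∈ A ∧ (u, v) ∉ Del
  have h4 : ∀ a b c d, E a b → E b c → E c d → E d a → False := by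
    intro a b c d h1 h2 h3 h5
    have hac : a ≠ c := by
      rintro rfl
      exact hasym _ _ h1.1 h2.1
    have hbd : b ≠ d := by
      rintro rfl
      exact hasym _ _ h2.1 h3.1
    have hdj : ∀ i, Disjoint (cycleArcs [a, b, c, d]) (cycleArcs (f i)) := by
      intro i
      rw [Set.disjoint_left]
      intro p hp hp'
      have hpD : p ∈ Del := Set.mem_iUnion.2 ⟨i, hp'⟩
      rw [cycleArcs_four] at hp
      rcases hp with rfl | rfl | rfl | rfl
      · exact h1.2 hpD
      · exact h2.2 hpD
      · exact h3.2 hpD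
      · exact h5.2 hpD
    refine hm1 ⟨Fin.cons [a, b, c, d] f, ?_, ?_⟩
    · intro i
      refine Fin.cases ?_ (fun j => ?_) i
      · refine ⟨⟨?_, by simp, ?_⟩, by simp⟩
        · simp [hne _ _ h1.1, hac, (hne _ _ h5.1).symm, hne _ _ h2.1, hbd, hne _ _ h3.1]
        · intro j
          have : ∀ p ∈ cycleArcs [a, b, c, d], p ∈ A := by
            intro p hp
            rw [cycleArcs_four] at hp
            rcases hp with rfl | rfl | rfl | rfl
            · exact h1.1
            · exact h2.1
            · exact h3.1
            · exact h5.1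
          exact this _ ⟨j, rfl⟩
      · simpa using hf j
    · intro i j
      refine Fin.cases ?_ (fun i => ?_) i <;> refine Fin.cases ?_ (fun j => ?_) j
      · intro h; exact absurd rfl h
      · intro _; simpa using hdj j
      · intro _; simpa using (hdj i).symm
      · intro h
        simpa using hdis i j (fun e => h (by rw [e]))
  obtain ⟨r, hinj, hr⟩ := exists_rank_univ E col (fun u v h => hcolA u v h.1) h4
  have hDelcard : Del.ncard ≤ 4 * m := by
    have h1 : Del.ncard ≤ ∑ i : Fin m, (cycleArcs (f i)).ncard :=
      Set.ncard_iUnion_le_of_fintype _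
    have h2 : ∑ i : Fin m, (cycleArcs (f i)).ncard ≤ ∑ _i : Fin m, 4 :=
      Finset.sum_le_sum fun i _ => (cycleArcs_card (f i) (hf i).2).2
    simp at h2
    omega
  have hN : {p : V × V | col p.1 ≠ col p.2 ∧ ¬ E p.1 p.2 ∧ ¬ E p.2 p.1}.ncard ≤ 2 * (4 * m) := by
    have hsub : {p : V × V | col p.1 ≠ col p.2 ∧ ¬ E p.1 p.2 ∧ ¬ E p.2 p.1} ⊆
        Del ∪ Prod.swap '' Del := by
      rintro ⟨u, v⟩ h
      obtain ⟨hc, n1, n2⟩ := h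
      rcases htot u v hc with h | h
      · exact Or.inl (by_contra fun h' => n1 ⟨h, h'⟩)
      · exact Or.inr ⟨(v, u), by_contra fun h' => n2 ⟨h, h'⟩, rfl⟩
    have h1 := Set.ncard_le_ncard hsub (Set.toFinite _)
    have h2 := Set.ncard_union_le Del (Prod.swap '' Del)
    have h3 := Set.ncard_image_le (f := Prod.swap) (Set.toFinite Del)
    omega
  refine ⟨{p ∈ A | r p.2 < r p.1}, ⟨fun p hp => hp.1, ?_⟩, ?_⟩
  · refine acyclic_of_rank _ r ?_
    rintro ⟨u, v⟩ ⟨hA, hn⟩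
    have h1 : ¬ r v < r u := fun h => hn ⟨hA, h⟩
    have h2 : r u ≠ r v := fun h => hne u v hA (hinj h)
    show r u < r v
    omega
  · have hsub : {p ∈ A | r p.2 < r p.1} ⊆
        {p : V × V | E p.1 p.2 ∧ r p.2 < r p.1} ∪
        ⋃ i, {p ∈ cycleArcs (f i) | r p.2 < r p.1} := by
      rintro ⟨u, v⟩ ⟨hA, hlt⟩
      by_cases hD : (u, v) ∈ Del
      · obtain ⟨i, hi⟩ := Set.mem_iUnion.1 hD
        exact Or.inr (Set.mem_iUnion.2 ⟨i, hi, hlt⟩)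
      · left
        exact ⟨⟨hA, hD⟩, hlt⟩
    have h1 := Set.ncard_le_ncard hsub (Set.toFinite _)
    have h2 := h1.trans (Set.ncard_union_le _ _)
    have h3 : (⋃ i, {p ∈ cycleArcs (f i) | r p.2 < r p.1}).ncard ≤
        ∑ i : Fin m, {p ∈ cycleArcs (f i) | r p.2 < r p.1}.ncard :=
      Set.ncard_iUnion_le_of_fintype _
    have h5 : ∑ i : Fin m, {p ∈ cycleArcs (f i) | r p.2 < r p.1}.ncard ≤ ∑ _i : Fin m, 3 :=
      Finset.sum_le_sum fun i _ => cycle_back_card r (f i) (hf i).2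
    simp only [Finset.sum_const, Finset.card_univ, Fintype.card_fin, smul_eq_mul] at h5
    omega
end
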